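/- arXiv:2509.19138 — 2 statements merged into one kernel-verified Lean document; each statement's English description precedes it below -/
import Mathlib

section
/- Let G be a compact second-countable topological abelian additive group with Haar probability measure λ. Let ν : G → [0,∞] be measurable, φ : G → ℝ bounded measurable, and w : G → [0,∞) measurable with ∫_G w dλ = 1. Define the mollification φ_w(x) := ∫_G φ(x − z) w(z) λ(dz). Then ∫∫_{G×G} |φ_w(x) − φ_w(y)|² ν(x−y) λ(dx) λ(dy) ≤ ∫∫_{G×G} |φ(x) − φ(y)|² ν(x−y) λ(dx) λ(dy), where both sides are interpreted in [0,∞]. -/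
open MeasureTheory Filter Topology Set
open scoped ENNReal

/-- Mollification contracts the nonlocal Dirichlet energy on a compact abelian group:
with `φ_w(x) = ∫ φ(x - z) w(z) dλ` for a probability density `w`, one has
`E(φ_w) ≤ E(φ)` where `E(ψ) = ∬ |ψ(x) - ψ(y)|² ν(x-y) dλ(x) dλ(y)`. -/
theorem stmt_14 {G : Type*} [AddCommGroup G] [TopologicalSpace G] [IsTopologicalAddGroup G]
    [CompactSpace G] [SecondCountableTopology G]
    [MeasurableSpace G] [BorelSpace G]
    (lam : Measure G) [lam.IsAddHaarMeasure] [IsProbabilityMeasure lam]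
    (ν : G → ℝ≥0∞) (hνmeas : Measurable ν)
    (φ : G → ℝ) (hφmeas : Measurable φ) (hφbdd : ∃ C : ℝ, ∀ x, |φ x| ≤ C)
    (w : G → ℝ) (hwmeas : Measurable w) (hwnonneg : ∀ x, 0 ≤ w x)
    (hwint : ∫⁻ x, ENNReal.ofReal (w x) ∂lam = 1) :
    (∫⁻ p : G × G,
        ENNReal.ofReal (((∫ z, φ (p.1 - z) * w z ∂lam) - (∫ z, φ (p.2 - z) * w z ∂lam)) ^ 2)
          * ν (p.1 - p.2) ∂(lam.prod lam))
      ≤ ∫⁻ p : G × G,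
          ENNReal.ofReal ((φ p.1 - φ p.2) ^ 2) * ν (p.1 - p.2) ∂(lam.prod lam) := by
  obtain ⟨C, hC⟩ := hφbdd
  have hwI : Integrable w lam := by
    refine ⟨hwmeas.aestronglyMeasurable, ?_⟩
    rw [hasFiniteIntegral_iff_ofReal (ae_of_all _ hwnonneg), hwint]
    exact ENNReal.one_lt_top
  have hw1 : ∫ z, w z ∂lam = 1 := by
    rw [integral_eq_lintegral_of_nonneg_ae (ae_of_all _ hwnonneg) hwmeas.aestronglyMeasurable,
      hwint, ENNReal.toReal_one]
  have hI : ∀ x, Integrable (fun z => φ (x - z) * w z) lam := by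
    intro x
    refine hwI.bdd_mul (c := C) ?_ (ae_of_all _ fun z => ?_)
    · exact (hφmeas.comp (measurable_const.sub measurable_id)).aestronglyMeasurable
    · simpa using hC (x - z)
  have jensen : ∀ x y : G,
      ENNReal.ofReal (((∫ z, φ (x - z) * w z ∂lam) - (∫ z, φ (y - z) * w z ∂lam)) ^ 2)
        ≤ ∫⁻ z, ENNReal.ofReal (w z) * ENNReal.ofReal ((φ (x - z) - φ (y - z)) ^ 2) ∂lam := by
    intro x y
    have hgm : Measurable (fun z => φ (x - z) - φ (y - z)) :=
      (hφmeas.comp (measurable_const.sub measurable_id)).sub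
        (hφmeas.comp (measurable_const.sub measurable_id))
    have hgI : Integrable (fun z => (φ (x - z) - φ (y - z)) * w z) lam := by
      simpa only [sub_mul] using (hI x).sub' (hI y)
    have hgI2 : Integrable (fun z => (φ (x - z) - φ (y - z)) ^ 2 * w z) lam := by
      refine hwI.bdd_mul (c := (2 * C) ^ 2) (hgm.pow_const 2).aestronglyMeasurable
        (ae_of_all _ fun z => ?_)
      have h1 := abs_le.1 (hC (x - z))
      have h2 := abs_le.1 (hC (y - z))
      rw [Real.norm_eq_abs, abs_of_nonneg (sq_nonneg _)]
      apply sq_le_sq' <;> linarith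
    have hm : (∫ z, φ (x - z) * w z ∂lam) - (∫ z, φ (y - z) * w z ∂lam)
        = ∫ z, (φ (x - z) - φ (y - z)) * w z ∂lam := by
      rw [← integral_sub (hI x) (hI y)]
      simp only [sub_mul]
    rw [hm]
    set m := ∫ z, (φ (x - z) - φ (y - z)) * w z ∂lam with hmdef
    have h0 : 0 ≤ ∫ z, (φ (x - z) - φ (y - z) - m) ^ 2 * w z ∂lam :=
      integral_nonneg fun z => mul_nonneg (sq_nonneg _) (hwnonneg z)
    have h1 : ∫ z, (φ (x - z) - φ (y - z) - m) ^ 2 * w z ∂lam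
        = (∫ z, (φ (x - z) - φ (y - z)) ^ 2 * w z ∂lam) - 2 * m * m + m ^ 2 * 1 := by
      have e : ∀ z, (φ (x - z) - φ (y - z) - m) ^ 2 * w z
          = (φ (x - z) - φ (y - z)) ^ 2 * w z - 2 * m * ((φ (x - z) - φ (y - z)) * w z)
            + m ^ 2 * w z := fun z => by ring
      simp_rw [e]
      rw [integral_add (hgI2.sub' (hgI.const_mul _)) (hwI.const_mul _),
        integral_sub hgI2 (hgI.const_mul _), integral_const_mul, integral_const_mul, hw1,
        ← hmdef]
    have h2 : m ^ 2 ≤ ∫ z, (φ (x - z) - φ (y - z)) ^ 2 * w z ∂lam := by nlinarith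
    refine (ENNReal.ofReal_le_ofReal h2).trans ?_
    rw [ofReal_integral_eq_lintegral_ofReal hgI2
      (ae_of_all _ fun z => mul_nonneg (sq_nonneg _) (hwnonneg z))]
    refine lintegral_mono fun z => ?_
    rw [mul_comm, ENNReal.ofReal_mul (hwnonneg z)]
  set F : G × G → ℝ≥0∞ := fun p => ENNReal.ofReal ((φ p.1 - φ p.2) ^ 2) * ν (p.1 - p.2) with hF
  have hFm : Measurable F := by
    have h1 : Measurable (fun p : G × G => φ p.1 - φ p.2) :=
      (hφmeas.comp measurable_fst).sub (hφmeas.comp measurable_snd)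
    exact (h1.pow_const 2).ennreal_ofReal.mul (hνmeas.comp (measurable_fst.sub measurable_snd))
  have hsub : Measurable (fun q : (G × G) × G => q.1 - (q.2, q.2)) :=
    Measurable.prodMk
      ((measurable_fst.comp measurable_fst).sub measurable_snd)
      ((measurable_snd.comp measurable_fst).sub measurable_snd)
  calc _ ≤ ∫⁻ p : G × G, ∫⁻ z, ENNReal.ofReal (w z) * F (p - (z, z)) ∂lam ∂(lam.prod lam) := by
        refine lintegral_mono fun p => ?_
        refine (mul_le_mul_left (jensen p.1 p.2) _).trans ?_
        rw [← lintegral_mul_const]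
        · refine lintegral_mono fun z => ?_
          simp only [hF, Prod.fst_sub, Prod.snd_sub, sub_sub_sub_cancel_right, mul_assoc]
          exact le_rfl
        · exact hwmeas.ennreal_ofReal.mul
            (((hφmeas.comp (measurable_const.sub measurable_id)).sub
              (hφmeas.comp (measurable_const.sub measurable_id))).pow_const 2).ennreal_ofReal
    _ = ∫⁻ z, ∫⁻ p : G × G, ENNReal.ofReal (w z) * F (p - (z, z)) ∂(lam.prod lam) ∂lam := by
        refine lintegral_lintegral_swap (Measurable.aemeasurable ?_)
        exact (hwmeas.ennreal_ofReal.comp measurable_snd).mul (hFm.comp hsub)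
    _ = ∫⁻ z, ENNReal.ofReal (w z) * ∫⁻ p, F p ∂(lam.prod lam) ∂lam := by
        refine lintegral_congr fun z => ?_
        have hz : Measurable (fun p : G × G => F (p - (z, z))) :=
          hFm.comp (measurable_id.sub_const (z, z))
        rw [lintegral_const_mul _ hz,
          lintegral_sub_right_eq_self F (z, z)]
    _ = _ := by
        rw [lintegral_mul_const _ hwmeas.ennreal_ofReal, hwint, one_mul]
end

section
/- Let G be a compact second-countable topological abelian additive group with Haar probability measure λ. Let ν : G → [0,∞] be measurable and φ : G → ℝ bounded measurable with E(φ) := ∫∫_{G×G} |φ(x) − φ(y)|² ν(x−y) λ(dx) λ(dy) < ∞. Let (wₙ)ₙ be measurable functions wₙ : G → [0,∞) with ∫_G wₙ dλ = 1, and set φₙ(x) := ∫_G φ(x − z) wₙ(z) λ(dz). If φₙ → φ λ-a.e., then ∫∫_{G×G} |(φₙ(x) − φ(x)) − (φₙ(y) − φ(y))|² ν(x−y) λ(dx) λ(dy) → 0 as n → ∞. -/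
open MeasureTheory Filter Topology Set
open scoped ENNReal

theorem aux_jensen {G : Type*} [MeasurableSpace G] (lam : Measure G)
    (f w : G → ℝ) (hf : Measurable f) (C : ℝ) (hC : ∀ x, |f x| ≤ C)
    (hw : Measurable w) (hw0 : ∀ x, 0 ≤ w x)
    (hw1 : ∫⁻ x, ENNReal.ofReal (w x) ∂lam = 1) :
    ENNReal.ofReal ((∫ z, f z * w z ∂lam) ^ 2) ≤
      ∫⁻ z, ENNReal.ofReal ((f z) ^ 2) * ENNReal.ofReal (w z) ∂lam := by
  set P := lam.withDensity (fun x => ENNReal.ofReal (w x)) with hP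
  have hPp : IsProbabilityMeasure P := ⟨by
    rw [hP, withDensity_apply _ MeasurableSet.univ, Measure.restrict_univ, hw1]⟩
  have hL : Measurable (fun x => ENNReal.ofReal (w x)) := hw.ennreal_ofReal
  have e1 : ∫ z, f z * w z ∂lam = ∫ z, f z ∂P := by
    rw [hP, integral_withDensity_eq_integral_toReal_smul hL (by simp)]
    refine integral_congr_ae (Eventually.of_forall fun z => ?_)
    simp [ENNReal.toReal_ofReal (hw0 z), mul_comm]
  have e2 : ∫⁻ z, ENNReal.ofReal ((f z) ^ 2) * ENNReal.ofReal (w z) ∂lam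
      = ∫⁻ z, ENNReal.ofReal ((f z) ^ 2) ∂P := by
    rw [hP, lintegral_withDensity_eq_lintegral_mul _ hL (by fun_prop)]
    simp [mul_comm]
  have hfi : Integrable f P :=
    Integrable.of_bound hf.aestronglyMeasurable C (Eventually.of_forall hC)
  have hf2 : Integrable (fun z => (f z) ^ 2) P := by
    refine Integrable.of_bound (hf.pow_const 2).aestronglyMeasurable (C ^ 2)
      (Eventually.of_forall fun z => ?_)
    rw [Real.norm_eq_abs, abs_pow]
    exact pow_le_pow_left₀ (abs_nonneg _) (hC z) 2
  rw [e1, e2, ← ofReal_integral_eq_lintegral_ofReal hf2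
    (Eventually.of_forall fun z => sq_nonneg _)]
  refine ENNReal.ofReal_le_ofReal ?_
  exact (even_two.convexOn_pow (𝕜 := ℝ)).map_integral_le (continuous_pow 2).continuousOn
    isClosed_univ (by simp) hfi hf2

theorem aux_contr {G : Type*} [AddCommGroup G] [MeasurableSpace G] [MeasurableAdd₂ G]
    [MeasurableSub₂ G]
    (lam : Measure G) [lam.IsAddRightInvariant] [SFinite lam]
    (ν : G → ℝ≥0∞) (hνmeas : Measurable ν)
    (φ : G → ℝ) (hφmeas : Measurable φ) (C : ℝ) (hφbdd : ∀ x, |φ x| ≤ C)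
    (w : G → ℝ) (hw : Measurable w) (hw0 : ∀ x, 0 ≤ w x)
    (hw1 : ∫⁻ x, ENNReal.ofReal (w x) ∂lam = 1) :
    ∫⁻ p : G × G, ENNReal.ofReal (((∫ z, φ (p.1 - z) * w z ∂lam)
        - (∫ z, φ (p.2 - z) * w z ∂lam)) ^ 2) * ν (p.1 - p.2) ∂(lam.prod lam)
      ≤ ∫⁻ p : G × G,
        ENNReal.ofReal ((φ p.1 - φ p.2) ^ 2) * ν (p.1 - p.2) ∂(lam.prod lam) := by
  have hwi : Integrable w lam := by
    refine ⟨hw.aestronglyMeasurable, ?_⟩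
    rw [hasFiniteIntegral_iff_ofReal (Eventually.of_forall hw0), hw1]
    exact ENNReal.one_lt_top
  have hi : ∀ x, Integrable (fun z => φ (x - z) * w z) lam := fun x =>
    hwi.bdd_mul (hφmeas.comp (measurable_const.sub measurable_id)).aestronglyMeasurable
      (Eventually.of_forall fun z => hφbdd (x - z))
  set F : G × G → ℝ≥0∞ := fun p => ENNReal.ofReal ((φ p.1 - φ p.2) ^ 2) * ν (p.1 - p.2) with hF
  have hFm : Measurable F := by fun_prop
  calc _ ≤ ∫⁻ p : G × G, ∫⁻ z, F (p.1 - z, p.2 - z) * ENNReal.ofReal (w z) ∂lam ∂(lam.prod lam) := by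
        refine lintegral_mono fun p => ?_
        have h1 : (∫ z, φ (p.1 - z) * w z ∂lam) - (∫ z, φ (p.2 - z) * w z ∂lam)
            = ∫ z, (φ (p.1 - z) - φ (p.2 - z)) * w z ∂lam := by
          rw [← integral_sub (hi _) (hi _)]
          simp [sub_mul]
        have h2 := aux_jensen lam (fun z => φ (p.1 - z) - φ (p.2 - z)) w (by fun_prop) (C + C)
          (fun z => (abs_sub _ _).trans (add_le_add (hφbdd _) (hφbdd _))) hw hw0 hw1
        dsimp only
        rw [h1]
        refine (mul_le_mul_left h2 _).trans ?_
        rw [← lintegral_mul_const _ (by fun_prop)]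
        refine lintegral_mono fun z => le_of_eq ?_
        simp only [hF, sub_sub_sub_cancel_right]
        ring
    _ = ∫⁻ z, ∫⁻ p : G × G, F (p.1 - z, p.2 - z) * ENNReal.ofReal (w z) ∂(lam.prod lam) ∂lam := by
        refine lintegral_lintegral_swap (Measurable.aemeasurable ?_)
        simp only [Function.uncurry_def]
        fun_prop
    _ = ∫⁻ z, (∫⁻ p, F p ∂(lam.prod lam)) * ENNReal.ofReal (w z) ∂lam := by
        refine lintegral_congr fun z => ?_
        rw [lintegral_mul_const _ (by fun_prop)]
        congr 1
        have hmp : MeasurePreserving (fun p : G × G => (p.1 - z, p.2 - z))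
            (lam.prod lam) (lam.prod lam) := by
          have h0 : MeasurePreserving (fun x : G => x - z) lam lam := measurePreserving_sub_right lam z
          exact h0.prod h0
        exact hmp.lintegral_comp hFm
    _ = _ := by
        rw [lintegral_const_mul _ (by fun_prop), hw1, mul_one]

theorem aux_lim (a b : ℕ → ℝ≥0∞) (T : ℝ≥0∞) (hT : T ≠ ⊤) (h : ∀ n, a n + b n ≤ T)
    (hb : T ≤ liminf b atTop) : Tendsto a atTop (𝓝 0) := by
  rw [ENNReal.tendsto_nhds_zero]
  intro ε hε
  rcases eq_or_ne T 0 with h0 | h0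
  · refine Eventually.of_forall fun n => ?_
    have := le_self_add.trans (h n)
    rw [h0] at this
    exact this.trans zero_le
  · have hlt : T - ε < liminf b atTop := (ENNReal.sub_lt_self hT h0 hε.ne').trans_le hb
    filter_upwards [eventually_lt_of_lt_liminf hlt] with n hn
    have hbt : b n ≠ ⊤ := ne_top_of_le_ne_top hT (le_add_self.trans (h n))
    have : a n + b n ≤ ε + b n := (h n).trans ((tsub_le_iff_left).1 hn.le)
    exact (ENNReal.add_le_add_iff_right hbt).1 this

/-- Convergence of mollifications in the nonlocal Dirichlet energy on a compact abelian
group: if `φ` has finite energy `E(φ) = ∬ |φ(x)-φ(y)|² ν(x-y) dλ dλ < ∞` and the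
mollifications `φₙ(x) = ∫ φ(x-z) wₙ(z) dλ` converge to `φ` λ-a.e., then
`E(φₙ - φ) → 0`. -/
theorem stmt_15 {G : Type*} [AddCommGroup G] [TopologicalSpace G] [IsTopologicalAddGroup G]
    [CompactSpace G] [SecondCountableTopology G]
    [MeasurableSpace G] [BorelSpace G]
    (lam : Measure G) [lam.IsAddHaarMeasure] [IsProbabilityMeasure lam]
    (ν : G → ℝ≥0∞) (hνmeas : Measurable ν)
    (φ : G → ℝ) (hφmeas : Measurable φ) (hφbdd : ∃ C : ℝ, ∀ x, |φ x| ≤ C)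
    (hφE : ∫⁻ p : G × G,
        ENNReal.ofReal ((φ p.1 - φ p.2) ^ 2) * ν (p.1 - p.2) ∂(lam.prod lam) < ⊤)
    (w : ℕ → G → ℝ) (hwmeas : ∀ n, Measurable (w n)) (hwnonneg : ∀ n x, 0 ≤ w n x)
    (hwint : ∀ n, ∫⁻ x, ENNReal.ofReal (w n x) ∂lam = 1)
    (hae : ∀ᵐ x ∂lam,
      Tendsto (fun n => ∫ z, φ (x - z) * w n z ∂lam) atTop (𝓝 (φ x))) :
    Tendsto (fun n => ∫⁻ p : G × G,
        ENNReal.ofReal ((((∫ z, φ (p.1 - z) * w n z ∂lam) - φ p.1)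
          - ((∫ z, φ (p.2 - z) * w n z ∂lam) - φ p.2)) ^ 2)
          * ν (p.1 - p.2) ∂(lam.prod lam)) atTop (𝓝 0) := by
  obtain ⟨C, hC⟩ := hφbdd
  set Φ : ℕ → G → ℝ := fun n x => ∫ z, φ (x - z) * w n z ∂lam with hΦ
  have hΦm : ∀ n, Measurable (Φ n) := by
    intro n
    have : StronglyMeasurable (fun p : G × G => φ (p.1 - p.2) * w n p.2) :=
      Measurable.stronglyMeasurable (by have := hwmeas n; fun_prop)
    exact this.integral_prod_right.measurable
  have hcontr := fun n => aux_contr lam ν hνmeas φ hφmeas C hC (w n) (hwmeas n) (hwnonneg n) (hwint n)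
  set E := ∫⁻ p : G × G,
        ENNReal.ofReal ((φ p.1 - φ p.2) ^ 2) * ν (p.1 - p.2) ∂(lam.prod lam) with hE
  set K : G × G → ℝ≥0∞ := fun p => ν (p.1 - p.2) with hK
  have hKm : Measurable K := by fun_prop
  set μ := (lam.prod lam).withDensity K with hμ
  have conv : ∀ g : G × G → ℝ, Measurable g →
      ∫⁻ p, ENNReal.ofReal ((g p) ^ 2) * ν (p.1 - p.2) ∂(lam.prod lam)
        = ∫⁻ p, ENNReal.ofReal ((g p) ^ 2) ∂μ := by
    intro g hg
    rw [hμ, lintegral_withDensity_eq_lintegral_mul _ hKm (by fun_prop)]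
    simp [mul_comm, hK]
  have hDm : Measurable (fun p : G × G => φ p.1 - φ p.2) := by fun_prop
  have hDnm : ∀ n, Measurable (fun p : G × G => Φ n p.1 - Φ n p.2) := fun n => by
    have := hΦm n
    fun_prop
  have hEμ : E = ∫⁻ p, ENNReal.ofReal ((φ p.1 - φ p.2) ^ 2) ∂μ := conv _ hDm
  have haeμ : ∀ᵐ p ∂μ, Tendsto (fun n => Φ n p.1) atTop (𝓝 (φ p.1)) ∧
      Tendsto (fun n => Φ n p.2) atTop (𝓝 (φ p.2)) := by
    refine (withDensity_absolutelyContinuous _ _).ae_le ?_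
    exact (Measure.quasiMeasurePreserving_fst.ae hae).and
      (Measure.quasiMeasurePreserving_snd.ae hae)
  refine aux_lim _ (fun n => ∫⁻ p, ENNReal.ofReal
    (((Φ n p.1 - Φ n p.2) + (φ p.1 - φ p.2)) ^ 2) ∂μ) (4 * E)
    (ENNReal.mul_ne_top (by simp) hφE.ne) (fun n => ?_) ?_
  · have hm := hΦm n
    have h1 := hcontr n
    rw [conv (fun p => Φ n p.1 - Φ n p.2) (hDnm n)] at h1
    rw [conv (fun p => (Φ n p.1 - φ p.1) - (Φ n p.2 - φ p.2)) (by fun_prop),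
      ← lintegral_add_left (by fun_prop)]
    calc _ = ∫⁻ p, (2 * ENNReal.ofReal ((Φ n p.1 - Φ n p.2) ^ 2)
            + 2 * ENNReal.ofReal ((φ p.1 - φ p.2) ^ 2)) ∂μ := by
          refine lintegral_congr fun p => ?_
          have h2 : (2 : ℝ≥0∞) = ENNReal.ofReal 2 := by simp
          rw [h2, ← ENNReal.ofReal_mul (by norm_num), ← ENNReal.ofReal_mul (by norm_num),
            ← ENNReal.ofReal_add (by positivity) (by positivity),
            ← ENNReal.ofReal_add (by positivity) (by positivity)]
          congr 1
          ring
      _ = 2 * ∫⁻ p, ENNReal.ofReal ((Φ n p.1 - Φ n p.2) ^ 2) ∂μ + 2 * E := by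
          rw [lintegral_add_left (by fun_prop), lintegral_const_mul _ (by fun_prop),
            lintegral_const_mul _ (by fun_prop), ← hEμ]
      _ ≤ 2 * E + 2 * E := by gcongr
      _ = 4 * E := by rw [← add_mul]; norm_num
  · calc 4 * E = ∫⁻ p, liminf (fun n => ENNReal.ofReal
            (((Φ n p.1 - Φ n p.2) + (φ p.1 - φ p.2)) ^ 2)) atTop ∂μ := by
          rw [hEμ, ← lintegral_const_mul _ (by fun_prop)]
          refine lintegral_congr_ae ?_
          filter_upwards [haeμ] with p hp
          have ht : Tendsto (fun n => ENNReal.ofReal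
            (((Φ n p.1 - Φ n p.2) + (φ p.1 - φ p.2)) ^ 2)) atTop
            (𝓝 (ENNReal.ofReal (((φ p.1 - φ p.2) + (φ p.1 - φ p.2)) ^ 2))) :=
            ENNReal.tendsto_ofReal (((hp.1.sub hp.2).add_const _).pow 2)
          rw [ht.liminf_eq]
          have h4 : (4 : ℝ≥0∞) = ENNReal.ofReal 4 := by simp
          rw [h4, ← ENNReal.ofReal_mul (by norm_num)]
          congr 1
          ring
      _ ≤ _ := lintegral_liminf_le fun n => by
          have := hΦm n
          fun_prop
end
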